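/- For k ≥ 1 and integers N ≥ s ≥ 1, the sum over all k-Dyck paths of length (k+1)N of the height at which the s-th up-step ends (the s-th max-turn level) equals sk/(kN+1) · binomial((k+1)N, N) − Σ_{i=1}^{s−1} (s−i) · (1/(ki+1))·binomial((k+1)i, i) · (k/(N−i+1))·binomial((k+1)(N−i), N−i). -/

import Mathlib

open Finset

def stepVal (k : ℕ) (b : Bool) : ℤ := if b then (k : ℤ) else -1

def pathHeight (k n : ℕ) (f : Fin n → Bool) (j : ℕ) : ℤ :=
  ∑ i ∈ Finset.range j, if h : i < n then stepVal k (f ⟨i, h⟩) else 0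

def IsDyckPath (k n : ℕ) (f : Fin n → Bool) : Prop :=
  (∀ j ≤ n, 0 ≤ pathHeight k n f j) ∧ pathHeight k n f n = 0

instance (k n : ℕ) : DecidablePred (IsDyckPath k n) := fun f => by
  unfold IsDyckPath; infer_instance

def dyckPaths (k n : ℕ) : Finset (Fin n → Bool) :=
  Finset.univ.filter (IsDyckPath k n)

/-- The number of down-steps of `f` occurring before the `s`-th up-step
(i.e. down-steps preceded by fewer than `s` up-steps). -/
def downsBefore (n : ℕ) (f : Fin n → Bool) (s : ℕ) : ℕ :=
  (Finset.univ.filter (fun i : Fin n =>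
    f i = false ∧ (Finset.univ.filter (fun j : Fin n => j < i ∧ f j = true)).card < s)).card

/-- The level at which the `s`-th up-step starts (the `s`-th min-turn level). -/
def minTurn (k n : ℕ) (f : Fin n → Bool) (s : ℕ) : ℚ :=
  (k : ℚ) * ((s : ℚ) - 1) - downsBefore n f s

/-- The level at which the `s`-th up-step ends (the `s`-th max-turn level). -/
def maxTurn (k n : ℕ) (f : Fin n → Bool) (s : ℕ) : ℚ :=
  (k : ℚ) * (s : ℚ) - downsBefore n f s


/-- Nonnegative paths starting at height `h` and ending at `0`. -/
def OkPath (k n : ℕ) (h : ℤ) (f : Fin n → Bool) : Prop :=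
  (∀ j ≤ n, 0 ≤ h + pathHeight k n f j) ∧ h + pathHeight k n f n = 0

lemma pathHeight_cons (k n : ℕ) (b : Bool) (g : Fin n → Bool) (j : ℕ) :
    pathHeight k (n + 1) (Fin.cons b g) (j + 1) = stepVal k b + pathHeight k n g j := by
  unfold pathHeight
  rw [Finset.sum_range_succ', add_comm]
  congr 1
  · simp
    rfl

lemma okPath_cons (k n : ℕ) (h : ℤ) (b : Bool) (g : Fin n → Bool) :
    OkPath k (n + 1) h (Fin.cons b g) ↔ 0 ≤ h ∧ OkPath k n (h + stepVal k b) g := by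
  unfold OkPath
  constructor
  · rintro ⟨h1, h2⟩
    refine ⟨by simpa [pathHeight] using h1 0 (by omega), ?_, ?_⟩
    · intro j hj
      have := h1 (j + 1) (by omega)
      rw [pathHeight_cons] at this
      linarith
    · rw [pathHeight_cons] at h2
      linarith
  · rintro ⟨h0, h1, h2⟩
    refine ⟨?_, ?_⟩
    · intro j hj
      cases j with
      | zero => simpa [pathHeight] using h0
      | succ j =>
        rw [pathHeight_cons]
        have := h1 j (by omega)
        linarith
    · rw [pathHeight_cons]
      linarith

open Classical in
/-- Sum of a statistic over nonnegative paths from height `h` to `0`. -/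
noncomputable def pathSum (k n : ℕ) (h : ℤ) (F : (Fin n → Bool) → ℚ) : ℚ :=
  ∑ f : Fin n → Bool, if OkPath k n h f then F f else 0

lemma pathSum_neg (k n : ℕ) (h : ℤ) (hh : h < 0) (F : (Fin n → Bool) → ℚ) :
    pathSum k n h F = 0 := by
  unfold pathSum
  apply Finset.sum_eq_zero
  intro f _
  rw [if_neg]
  rintro ⟨h1, _⟩
  have := h1 0 (by omega)
  simp [pathHeight] at this
  omega

lemma pathSum_succ (k n : ℕ) (h : ℤ) (hh : 0 ≤ h) (F : (Fin (n + 1) → Bool) → ℚ) :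
    pathSum k (n + 1) h F = pathSum k n (h + k) (fun g => F (Fin.cons true g)) +
      pathSum k n (h - 1) (fun g => F (Fin.cons false g)) := by
  classical
  unfold pathSum
  rw [← (Fin.consEquiv (fun _ : Fin (n + 1) => Bool)).sum_comp, Fintype.sum_prod_type,
    Fintype.sum_bool]
  congr 1
  · apply Finset.sum_congr rfl
    intro g _
    have := okPath_cons k n h true g
    simp only [Fin.consEquiv, Equiv.coe_fn_mk]
    simp only [this, hh, true_and, stepVal, if_true]
  · apply Finset.sum_congr rfl
    intro g _
    have := okPath_cons k n h false g
    simp only [Fin.consEquiv, Equiv.coe_fn_mk]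
    simp only [this, hh, true_and, stepVal, sub_eq_add_neg]
    simp

lemma pathSum_zero (k : ℕ) (F : (Fin 0 → Bool) → ℚ) :
    pathSum k 0 0 F = F Fin.elim0 := by
  unfold pathSum
  rw [Fintype.sum_unique, if_pos]
  · congr 1
  · simp [OkPath, pathHeight]

lemma pathSum_lt (k n : ℕ) : ∀ (h : ℤ) (_ : (n : ℤ) < h) (F : (Fin n → Bool) → ℚ),
    pathSum k n h F = 0 := by
  induction n with
  | zero =>
    intro h hh F
    unfold pathSum
    apply Finset.sum_eq_zero
    intro f _
    rw [if_neg]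
    rintro ⟨_, h1⟩
    simp [pathHeight] at h1
    simp at hh
    omega
  | succ n ih =>
    intro h hh F
    push_cast at hh
    rw [pathSum_succ k n h (by omega), ih _ (by omega), ih _ (by omega), add_zero]

lemma pathSum_add (k n : ℕ) (h : ℤ) (F G : (Fin n → Bool) → ℚ) :
    pathSum k n h (fun f => F f + G f) = pathSum k n h F + pathSum k n h G := by
  classical
  unfold pathSum
  rw [← Finset.sum_add_distrib]
  apply Finset.sum_congr rfl
  intro f _
  split_ifs <;> simp

lemma downsBefore_zero (n : ℕ) (f : Fin n → Bool) : downsBefore n f 0 = 0 := by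
  simp [downsBefore]

lemma ups_cons (n : ℕ) (b : Bool) (g : Fin n → Bool) (i : Fin n) :
    (Finset.univ.filter (fun j : Fin (n + 1) => j < i.succ ∧
      (Fin.cons b g : Fin (n + 1) → Bool) j = true)).card =
    (if b then 1 else 0) + (Finset.univ.filter (fun j : Fin n => j < i ∧ g j = true)).card := by
  rw [Fin.card_filter_univ_succ]
  cases b <;> simp [add_comm]

lemma downsBefore_true (n : ℕ) (g : Fin n → Bool) (s : ℕ) :
    downsBefore (n + 1) (Fin.cons true g) (s + 1) = downsBefore n g s := by
  unfold downsBefore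
  rw [Fin.card_filter_univ_succ]
  simp only [Fin.cons_zero, Fin.cons_succ, ups_cons]
  simp [Nat.add_comm 1]

lemma downsBefore_false (n : ℕ) (g : Fin n → Bool) (s : ℕ) :
    downsBefore (n + 1) (Fin.cons false g) (s + 1) = downsBefore n g (s + 1) + 1 := by
  unfold downsBefore
  rw [Fin.card_filter_univ_succ]
  simp only [Fin.cons_zero, Fin.cons_succ, ups_cons]
  simp

/-- Number of paths from height `h` to `0` with `m` up-steps. -/
def wCount (k : ℕ) : ℕ → ℕ → ℚ
  | 0, _ => 1
  | m + 1, h => ∑ x ∈ range (h + 1), wCount k m (x + k)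

/-- Partial sums of `wCount` in the height variable. -/
def eCount (k m h : ℕ) : ℚ := ∑ x ∈ range h, wCount k m x

lemma wCount_zero (k h : ℕ) : wCount k 0 h = 1 := by rw [wCount]

lemma wCount_succ_zero (k m : ℕ) : wCount k (m + 1) 0 = wCount k m k := by
  rw [wCount]; simp

lemma wCount_succ_succ (k m h : ℕ) :
    wCount k (m + 1) (h + 1) = wCount k (m + 1) h + wCount k m (h + 1 + k) := by
  rw [wCount, sum_range_succ, ← wCount]

lemma eCount_add_succ (k m h : ℕ) :
    eCount k m (h + 1 + k) = eCount k m k + wCount k (m + 1) h := by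
  unfold eCount
  rw [wCount, add_comm (h + 1) k, sum_range_add]
  simp [add_comm]

lemma eCount_succ (k m h : ℕ) : eCount k m (h + 1) = eCount k m h + wCount k m h := by
  unfold eCount
  rw [sum_range_succ]

lemma pathSum_one (k n : ℕ) : ∀ (m h : ℕ), n = (k + 1) * m + h →
    pathSum k n h (fun _ => 1) = wCount k m h := by
  induction n with
  | zero =>
    intro m h hn
    have h0 : h = 0 := by omega
    have hm : m = 0 := by
      by_contra hne
      have : 0 < (k + 1) * m := by positivity
      omega
    subst h0 hm
    rw [Nat.cast_zero, pathSum_zero, wCount_zero]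
  | succ n ih =>
    intro m h hn
    rw [pathSum_succ _ _ _ (by omega)]
    rcases m with _ | m <;> rcases h with _ | h
    · omega
    · rw [pathSum_lt _ _ _ (by push_cast; omega)]
      have := ih 0 h (by omega)
      push_cast
      simp only [add_sub_cancel_right]
      rw [this]
      simp [wCount_zero]
    · rw [pathSum_neg _ _ (_ - 1) (by simp)]
      have := ih m k (by rw [mul_add] at hn; omega)
      simp only [Nat.cast_zero, zero_add, add_zero]
      rw [this, wCount_succ_zero]
    · have h1 := ih (m + 1) h (by omega)
      have h2 := ih m (h + 1 + k) (by rw [mul_add] at hn; omega)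
      push_cast at h2 ⊢
      simp only [add_sub_cancel_right]
      rw [h1, h2, wCount_succ_succ]
      ring

/-- Conjectured value of the cumulative number of down-steps before the `(s+1)`-st up-step. -/
def bVal (k m h s : ℕ) : ℚ :=
  (s + 1) * eCount k m h +
    ∑ i ∈ range s, ((s : ℚ) - i) * wCount k (i + 1) h * eCount k (m - (i + 1)) k

lemma bVal_rec (k m h s : ℕ) :
    bVal k (m + 1) (h + 1) (s + 1) =
      bVal k m (h + 1 + k) s + bVal k (m + 1) h (s + 1) + wCount k (m + 1) h := by
  unfold bVal
  rw [sum_range_succ', sum_range_succ' _ s, eCount_add_succ, eCount_succ]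
  simp only [wCount_succ_succ k _ h, Nat.add_sub_add_right, mul_add, add_mul, sum_add_distrib]
  simp only [wCount_zero, Nat.sub_zero]
  have : ∀ i : ℕ, (((s + 1 : ℕ) : ℚ) - ((i + 1 : ℕ) : ℚ)) = (s : ℚ) - i := by
    intro i; push_cast; ring
  simp only [this]
  push_cast
  ring

lemma bVal_rec_zero (k m s : ℕ) :
    bVal k (m + 1) 0 (s + 1) = bVal k m k s := by
  unfold bVal
  rw [sum_range_succ']
  simp only [wCount_succ_zero, Nat.add_sub_add_right, wCount_zero, Nat.sub_zero]
  have : ∀ i : ℕ, (((s + 1 : ℕ) : ℚ) - ((i + 1 : ℕ) : ℚ)) = (s : ℚ) - i := by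
    intro i; push_cast; ring
  simp only [this]
  have : eCount k (m + 1) 0 = 0 := by simp [eCount]
  rw [this]
  push_cast
  ring

lemma pathSum_const_zero (k n : ℕ) (h : ℤ) : pathSum k n h (fun _ => 0) = 0 := by
  simp [pathSum]

lemma pathSum_downs (k n : ℕ) : ∀ (m h s : ℕ), n = (k + 1) * m + h → s ≤ m →
    pathSum k n h (fun f => (downsBefore n f (s + 1) : ℚ)) = bVal k m h s := by
  induction n with
  | zero =>
    intro m h s hn hs
    have h0 : h = 0 := by omega
    have hm : m = 0 := by
      by_contra hne
      have : 0 < (k + 1) * m := by positivity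
      omega
    have hs0 : s = 0 := by omega
    subst h0 hm hs0
    rw [Nat.cast_zero, pathSum_zero]
    simp [downsBefore, bVal, eCount]
  | succ n ih =>
    intro m h s hn hs
    rw [pathSum_succ _ _ _ (by omega)]
    simp only [downsBefore_true, downsBefore_false, Nat.cast_add, Nat.cast_one]
    rw [pathSum_add]
    rcases h with _ | h
    · rw [pathSum_neg _ _ (_ - 1) (by simp), pathSum_neg _ _ (_ - 1) (by simp)]
      rcases m with _ | m
      · omega
      rcases s with _ | s
      · simp [downsBefore_zero, pathSum_const_zero, bVal, eCount]
      · have := ih m k s (by rw [mul_add] at hn; omega) (by omega)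
        simp only [Nat.cast_zero, zero_add, add_zero]
        rw [this, bVal_rec_zero]
    · have h1 := ih m h s (by omega) hs
      have h2 := pathSum_one k n m h (by omega)
      push_cast
      simp only [add_sub_cancel_right]
      rw [h1, h2]
      rcases s with _ | s
      · simp [downsBefore_zero, pathSum_const_zero, bVal, eCount_succ]
      · rcases m with _ | m
        · omega
        have := ih m (h + 1 + k) s (by rw [mul_add] at hn; omega) (by omega)
        push_cast at this
        rw [this, bVal_rec]
        ring

/-- Closed form of `wCount`. -/
lemma wCount_closed (k m : ℕ) : ∀ h, wCount k (m + 1) h =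
    (((k + 1) * (m + 1) + h).choose (m + 1) : ℚ) - k * (((k + 1) * (m + 1) + h).choose m : ℚ) := by
  induction m with
  | zero =>
    intro h
    rw [wCount]
    simp [wCount_zero]
    ring
  | succ m ih =>
    intro h
    induction h with
    | zero =>
      rw [wCount_succ_zero, ih]
      have e : (k + 1) * (m + 1 + 1) + 0 = ((k + 1) * (m + 1) + k) + 1 := by ring
      rw [e]
      set n := (k + 1) * (m + 1) + k with hn
      rw [Nat.choose_succ_succ n (m + 1), Nat.choose_succ_succ n m]
      have h1 := Nat.choose_succ_right_eq n (m + 1)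
      have h2 : n - (m + 1) = k * (m + 2) := by
        have : n = k * (m + 2) + (m + 1) := by rw [hn]; ring
        omega
      rw [h2] at h1
      have h3 : n.choose (m + 1 + 1) = k * n.choose (m + 1) := by
        apply Nat.eq_of_mul_eq_mul_right (show 0 < m + 1 + 1 by omega)
        rw [h1]; ring
      simp only [Nat.succ_eq_add_one, h3]
      push_cast
      ring
    | succ h ihh =>
      rw [wCount_succ_succ, ihh, ih]
      have e : (k + 1) * (m + 1 + 1) + (h + 1) = ((k + 1) * (m + 1 + 1) + h) + 1 := by ring
      have e2 : (k + 1) * (m + 1) + (h + 1 + k) = ((k + 1) * (m + 1 + 1) + h) := by ring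
      rw [e, e2]
      set n := (k + 1) * (m + 1 + 1) + h with hn
      rw [Nat.choose_succ_succ n (m + 1), Nat.choose_succ_succ n m]
      simp only [Nat.succ_eq_add_one]
      push_cast
      ring

lemma wCount_final (k m : ℕ) :
    wCount k m 0 = (((k + 1) * m).choose m : ℚ) / (k * m + 1) := by
  rcases m with _ | m
  · simp [wCount_zero]
  rw [wCount_closed, add_zero]
  have h1 := Nat.choose_succ_right_eq ((k + 1) * (m + 1)) m
  have h2 : (k + 1) * (m + 1) - m = k * (m + 1) + 1 := by
    have : (k + 1) * (m + 1) = k * (m + 1) + 1 + m := by ring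
    omega
  rw [h2] at h1
  have h3 : (((k + 1) * (m + 1)).choose (m + 1) : ℚ) * (m + 1) =
      (((k + 1) * (m + 1)).choose m : ℚ) * (k * (m + 1) + 1) := by exact_mod_cast h1
  have h4 : (k : ℚ) * (m + 1) + 1 ≠ 0 := by positivity
  push_cast
  rw [eq_div_iff h4]
  linear_combination (k : ℚ) * h3

lemma eCount_closed (k m : ℕ) : ∀ h, eCount k (m + 1) h =
    (((k + 1) * (m + 1) + h).choose (m + 2) : ℚ) - (((k + 1) * (m + 1)).choose (m + 2) : ℚ)
    - k * ((((k + 1) * (m + 1) + h).choose (m + 1) : ℚ)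
      - (((k + 1) * (m + 1)).choose (m + 1) : ℚ)) := by
  intro h
  induction h with
  | zero => simp [eCount]
  | succ h ih =>
    rw [eCount_succ, ih, wCount_closed, ← add_assoc, Nat.choose_succ_succ _ (m + 1),
      Nat.choose_succ_succ _ m]
    simp only [Nat.succ_eq_add_one]
    push_cast
    ring

lemma eCount_final (k m : ℕ) :
    eCount k m k = (k : ℚ) / (m + 1) * (((k + 1) * m).choose m : ℚ) := by
  rcases m with _ | m
  · simp [eCount, wCount_zero]
  rw [eCount_closed]
  have h1 := Nat.choose_succ_right_eq ((k + 1) * (m + 1) + k) (m + 1)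
  have h2 := Nat.choose_succ_right_eq ((k + 1) * (m + 1)) (m + 1)
  have e1 : (k + 1) * (m + 1) + k - (m + 1) = k * (m + 2) := by
    have : (k + 1) * (m + 1) + k = k * (m + 2) + (m + 1) := by ring
    omega
  have e2 : (k + 1) * (m + 1) - (m + 1) = k * (m + 1) := by
    have : (k + 1) * (m + 1) = k * (m + 1) + (m + 1) := by ring
    omega
  rw [e1] at h1
  rw [e2] at h2
  have h3 : (((k + 1) * (m + 1) + k).choose (m + 2) : ℚ) * (m + 2) =
      (((k + 1) * (m + 1) + k).choose (m + 1) : ℚ) * (k * (m + 2)) := by exact_mod_cast h1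
  have h4 : (((k + 1) * (m + 1)).choose (m + 2) : ℚ) * (m + 2) =
      (((k + 1) * (m + 1)).choose (m + 1) : ℚ) * (k * (m + 1)) := by exact_mod_cast h2
  have h5 : (m : ℚ) + 1 + 1 ≠ 0 := by positivity
  push_cast
  rw [div_mul_eq_mul_div, eq_div_iff h5]
  linear_combination h3 - h4

/-- The sum, over all `k`-Dyck paths of length `(k+1)N`, of the level at which the `s`-th
up-step ends. -/
theorem cumulative_maxTurn (k N s : ℕ) (hk : 1 ≤ k) (hs : 1 ≤ s) (hsN : s ≤ N) :
    ∑ f ∈ dyckPaths k ((k + 1) * N), maxTurn k ((k + 1) * N) f s =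
      (s : ℚ) * k / (k * N + 1) * (((k + 1) * N).choose N : ℚ) -
        ∑ i ∈ Finset.Icc 1 (s - 1), ((s : ℚ) - i) *
          ((((k + 1) * i).choose i : ℚ) / (k * i + 1)) *
          ((k : ℚ) / (N - i + 1) * (((k + 1) * (N - i)).choose (N - i) : ℚ)) := by
  classical
  have conv : ∀ F : (Fin ((k + 1) * N) → Bool) → ℚ,
      ∑ f ∈ dyckPaths k ((k + 1) * N), F f = pathSum k ((k + 1) * N) (0 : ℕ) F := by
    intro F
    unfold dyckPaths pathSum
    rw [Finset.sum_filter]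
    apply Finset.sum_congr rfl
    intro f _
    have : IsDyckPath k ((k + 1) * N) f ↔ OkPath k ((k + 1) * N) (0 : ℕ) f := by
      simp [IsDyckPath, OkPath]
    simp only [this]
  obtain ⟨t, rfl⟩ : ∃ t, s = t + 1 := ⟨s - 1, by omega⟩
  have h1 := pathSum_one k _ N 0 rfl
  have h2 := pathSum_downs k _ N 0 t rfl (by omega)
  rw [add_zero, ← conv] at h1 h2
  unfold maxTurn
  rw [Finset.sum_sub_distrib, h2]
  have h3 : ∑ f ∈ dyckPaths k ((k + 1) * N), (k : ℚ) * ((t + 1 : ℕ) : ℚ) =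
      (k : ℚ) * ((t + 1 : ℕ) : ℚ) * wCount k N 0 := by
    rw [← h1, Finset.mul_sum]
    simp
  rw [h3, wCount_final]
  congr 1
  · ring
  · unfold bVal
    have e0 : eCount k N 0 = 0 := by simp [eCount]
    rw [e0, mul_zero, zero_add, Nat.add_sub_cancel, Finset.range_eq_Ico]
    have e1 : Finset.Icc 1 t = Finset.Ico (0 + 1) (t + 1) := by
      ext x
      simp only [Finset.mem_Icc, Finset.mem_Ico]
      omega
    rw [e1, ← Finset.sum_Ico_add' _ 0 t 1]
    apply Finset.sum_congr rfl
    intro i hi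
    have hit : i < t := (Finset.mem_Ico.mp hi).2
    rw [wCount_final, eCount_final, Nat.cast_sub (show i + 1 ≤ N by omega)]
    push_cast
    ring
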